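/- For any γ: (1) if the rooted graph (G,K) forbids (W_k, K_{W_k}) as a rooted minor, then the rooted signed graph (G,γ,K) forbids the rooted grid 𝒲_k as a rooted signed graph minor; (2) conversely, if (G,γ,K) forbids 𝒲_k as a rooted signed graph minor, then (G,K) forbids (W_{k²}, K_{W_{k²}}) as a rooted minor. -/

import Mathlib

namespace TDMPaper

/-- A finite multigraph without loops: edges carry their unordered pair of endpoints. -/
structure MGraph where
  V : Type
  E : Type
  finV : Finite V
  finE : Finite E
  ends : E → Sym2 V
  loopless : ∀ e, ¬ (ends e).IsDiag

attribute [instance] MGraph.finV MGraph.finE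

namespace MGraph

/-- A cycle in a multigraph, given by cyclically ordered distinct vertices and
distinct edges. -/
structure Cycle (G : MGraph) where
  n : ℕ
  npos : 0 < n
  vtx : Fin n → G.V
  edge : Fin n → G.E
  vtx_inj : Function.Injective vtx
  edge_inj : Function.Injective edge
  ends_eq : ∀ i : Fin n,
    G.ends (edge i) = s(vtx i, vtx ⟨(i.1 + 1) % n, Nat.mod_lt _ npos⟩)

/-- The parity of a cycle with respect to a signing `γ`. -/
def Cycle.parity {G : MGraph} (C : G.Cycle) (γ : G.E → ZMod 2) : ZMod 2 :=
  ∑ i, γ (C.edge i)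

/-- The vertex set of a cycle. -/
def Cycle.support {G : MGraph} (C : G.Cycle) : Set G.V := Set.range C.vtx

/-- The odd cycle packing number of a signed graph: the maximum number of pairwise
vertex-disjoint odd cycles. -/
noncomputable def OCP (G : MGraph) (γ : G.E → ZMod 2) : ℕ :=
  sSup {k : ℕ | ∃ C : Fin k → G.Cycle,
    (∀ i, (C i).parity γ = 1) ∧
    ∀ i j, i ≠ j → Disjoint ((C i).support) ((C j).support)}

/-- The subgraph induced by a vertex set `S` (kept on the same vertex type; only
edges with both endpoints in `S` survive). -/
def induce (G : MGraph) (S : Set G.V) : MGraph where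
  V := G.V
  E := {e : G.E // ∀ v ∈ G.ends e, v ∈ S}
  finV := G.finV
  finE := inferInstance
  ends := fun e => G.ends e.1
  loopless := fun e => G.loopless e.1

/-- The odd cycle packing number of the subgraph induced on `S`, signs inherited. -/
noncomputable def OCPOn (G : MGraph) (γ : G.E → ZMod 2) (S : Set G.V) : ℕ :=
  (G.induce S).OCP (fun e => γ e.1)

/-- A path in a multigraph. -/
structure Path (G : MGraph) where
  n : ℕ
  vtx : Fin (n + 1) → G.V
  edge : Fin n → G.E
  vtx_inj : Function.Injective vtx
  ends_eq : ∀ i : Fin n, G.ends (edge i) = s(vtx i.castSucc, vtx i.succ)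

def Path.first {G : MGraph} (P : G.Path) : G.V := P.vtx 0
def Path.last {G : MGraph} (P : G.Path) : G.V := P.vtx (Fin.last P.n)
def Path.support {G : MGraph} (P : G.Path) : Set G.V := Set.range P.vtx
def Path.internals {G : MGraph} (P : G.Path) : Set G.V :=
  P.support \ {P.first, P.last}
def Path.parity {G : MGraph} (P : G.Path) (γ : G.E → ZMod 2) : ZMod 2 :=
  ∑ i, γ (P.edge i)

end MGraph

open MGraph

/-- `γ'` is obtained from `γ` by a sequence of shiftings at vertices. -/
def IsShift (G : MGraph) (γ γ' : G.E → ZMod 2) : Prop :=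
  ∃ σ : G.V → ZMod 2, ∀ e u v, G.ends e = s(u, v) → γ' e = γ e + σ u + σ v

/-- A minor model of `H` in `G`: disjoint nonempty connected branch sets and an
injective assignment of edges. -/
structure MinorModel (H G : MGraph) where
  bs : H.V → Set G.V
  em : H.E → G.E
  bs_nonempty : ∀ v, (bs v).Nonempty
  bs_disjoint : ∀ u v, u ≠ v → Disjoint (bs u) (bs v)
  bs_connected : ∀ v, ∀ a ∈ bs v, ∀ b ∈ bs v,
    Relation.ReflTransGen
      (fun x y => x ∈ bs v ∧ y ∈ bs v ∧ ∃ e, G.ends e = s(x, y)) a b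
  em_inj : Function.Injective em
  em_ends : ∀ eH u v, H.ends eH = s(u, v) →
    ∃ a ∈ bs u, ∃ b ∈ bs v, G.ends (em eH) = s(a, b)

/-- `H` is a minor of `G`. -/
def IsMinor (H G : MGraph) : Prop := Nonempty (MinorModel H G)

/-- `(H,KH)` is a rooted minor of `(G,KG)`: there is a minor model in which the
branch set of every root of `H` contains a root of `G`. -/
def IsRootedMinor (H : MGraph) (KH : Set H.V) (G : MGraph) (KG : Set G.V) : Prop :=
  ∃ M : MinorModel H G, ∀ v ∈ KH, (M.bs v ∩ KG).Nonempty

/-- A signed minor model of `(H,γH)` in `(G,γG)`: after shifting, branch sets are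
connected through even edges and edges of `H` get edges of `G` of the correct sign. -/
structure SignedMinorModel (H G : MGraph) (γH : H.E → ZMod 2) (γG : G.E → ZMod 2) where
  γ' : G.E → ZMod 2
  shift : IsShift G γG γ'
  bs : H.V → Set G.V
  em : H.E → G.E
  bs_nonempty : ∀ v, (bs v).Nonempty
  bs_disjoint : ∀ u v, u ≠ v → Disjoint (bs u) (bs v)
  bs_connected : ∀ v, ∀ a ∈ bs v, ∀ b ∈ bs v,
    Relation.ReflTransGen
      (fun x y => x ∈ bs v ∧ y ∈ bs v ∧ ∃ e, γ' e = 0 ∧ G.ends e = s(x, y)) a b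
  em_inj : Function.Injective em
  em_ends : ∀ eH u v, H.ends eH = s(u, v) →
    ∃ a ∈ bs u, ∃ b ∈ bs v, G.ends (em eH) = s(a, b)
  em_parity : ∀ eH, γ' (em eH) = γH eH

/-- `(H,γH)` is a signed graph minor of `(G,γG)`. -/
def IsSignedMinor (H : MGraph) (γH : H.E → ZMod 2) (G : MGraph)
    (γG : G.E → ZMod 2) : Prop :=
  Nonempty (SignedMinorModel H G γH γG)

/-- `(H,γH,KH)` is a rooted signed graph minor of `(G,γG,KG)`. -/
def IsRootedSignedMinor (H : MGraph) (γH : H.E → ZMod 2) (KH : Set H.V)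
    (G : MGraph) (γG : G.E → ZMod 2) (KG : Set G.V) : Prop :=
  ∃ M : SignedMinorModel H G γH γG, ∀ v ∈ KH, (M.bs v ∩ KG).Nonempty

/-- An odd minor model of `H` in `G`: a minor model together with a 2-colouring of
`G` which is proper on each branch set (branch sets are connected through
bichromatic edges) and for which every model edge is monochromatic. -/
structure OddMinorModel (H G : MGraph) where
  bs : H.V → Set G.V
  em : H.E → G.E
  col : G.V → ZMod 2
  bs_nonempty : ∀ v, (bs v).Nonempty
  bs_disjoint : ∀ u v, u ≠ v → Disjoint (bs u) (bs v)
  bs_connected : ∀ v, ∀ a ∈ bs v, ∀ b ∈ bs v,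
    Relation.ReflTransGen
      (fun x y => x ∈ bs v ∧ y ∈ bs v ∧ col x ≠ col y ∧ ∃ e, G.ends e = s(x, y)) a b
  em_inj : Function.Injective em
  em_ends : ∀ eH u v, H.ends eH = s(u, v) →
    ∃ a ∈ bs u, ∃ b ∈ bs v, G.ends (em eH) = s(a, b)
  em_mono : ∀ eH u v, G.ends (em eH) = s(u, v) → col u = col v

/-- `G` contains `H` as an odd-minor. -/
def IsOddMinor (H G : MGraph) : Prop := Nonempty (OddMinorModel H G)

/-- `(G,γG)` contains `(H,γH)` as a subdivision. -/
def IsSignedSubdivision (H : MGraph) (γH : H.E → ZMod 2) (G : MGraph)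
    (γG : G.E → ZMod 2) : Prop :=
  ∃ (γH' : H.E → ZMod 2) (_ : IsShift H γH γH')
    (φV : H.V → G.V) (φE : H.E → G.Path),
    Function.Injective φV ∧
    (∀ eH u v, H.ends eH = s(u, v) →
      s((φE eH).first, (φE eH).last) = s(φV u, φV v)) ∧
    (∀ eH, (φE eH).parity γG = γH' eH) ∧
    (∀ e e', e ≠ e' → Disjoint ((φE e).internals) ((φE e').support)) ∧
    (∀ e, Disjoint ((φE e).internals) (Set.range φV))

/-! ## Tree decompositions and width parameters -/

/-- A tree decomposition of a multigraph. -/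
structure TreeDecomp (G : MGraph) where
  ι : Type
  tree : SimpleGraph ι
  isTree : tree.IsTree
  bag : ι → Set G.V
  covers_vertex : ∀ v, ∃ t, v ∈ bag t
  covers_edge : ∀ e, ∃ t, ∀ v ∈ G.ends e, v ∈ bag t
  bag_connected : ∀ v, (tree.induce {t | v ∈ bag t}).Connected

/-- A node of a tree is a leaf if it has at most one neighbour. -/
def IsLeaf {ι : Type} (T : SimpleGraph ι) (t : ι) : Prop :=
  (T.neighborSet t).Subsingleton

/-- A tree `K`-free-decomposition. -/
structure KFreeDecomp (G : MGraph) (K : Set G.V) extends TreeDecomp G where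
  L : Set G.V
  L_disj : Disjoint L K
  unique_bag : ∀ v ∈ L, ∃! t, v ∈ bag t
  leaf_bag : ∀ v ∈ L, ∀ t, v ∈ bag t → IsLeaf tree t

/-- The width of a tree `K`-free-decomposition: `max {0, max_t |β(t)\L| - 1}`. -/
noncomputable def KFreeDecomp.width {G : MGraph} {K : Set G.V}
    (D : KFreeDecomp G K) : ℕ :=
  ⨆ t : D.ι, ((D.bag t \ D.L).ncard - 1)

/-- The `K`-free treewidth of `(G,K)`. -/
noncomputable def twK (G : MGraph) (K : Set G.V) : ℕ :=
  sInf {w | ∃ D : KFreeDecomp G K, D.width = w}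

/-- A tame OCP-tree-decomposition of a signed graph. -/
structure TameOCPDecomp (G : MGraph) (γ : G.E → ZMod 2) extends TreeDecomp G where
  prot : ι → Set G.V
  prot_sub : ∀ t, prot t ⊆ bag t
  prot_adh : ∀ t t', tree.Adj t t' → ((bag t ∩ bag t') \ prot t).ncard ≤ 1

/-- The tame width (t-width) of a tame OCP-tree-decomposition. -/
noncomputable def TameOCPDecomp.twidth {G : MGraph} {γ : G.E → ZMod 2}
    (D : TameOCPDecomp G γ) : ℕ :=
  ⨆ t : D.ι, ((D.prot t).ncard + G.OCPOn γ (D.bag t \ D.prot t))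

/-- The tame OCP-treewidth of a signed graph. -/
noncomputable def tOCPtw (G : MGraph) (γ : G.E → ZMod 2) : ℕ :=
  sInf {w | ∃ D : TameOCPDecomp G γ, D.twidth = w}

/-- A TDM-tree-decomposition of a rooted signed graph. -/
structure TDMDecomp (G : MGraph) (γ : G.E → ZMod 2) (K : Set G.V)
    extends TreeDecomp G where
  prot : ι → Set G.V
  J : Set ι
  J_subtree : J.Nonempty → (tree.induce J).Connected
  prot_sub : ∀ t, prot t ⊆ bag t
  prot_roots : ∀ t, K ∩ bag t ⊆ prot t
  prot_adh : ∀ t t', tree.Adj t t' → ((bag t ∩ bag t') \ prot t).ncard ≤ 1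
  strong : ∀ t ∈ J, ∀ t', tree.Adj t t' → bag t ∩ bag t' ⊆ prot t
  roots_in_J : K ⊆ ⋃ j ∈ J, bag j

/-- The width of a TDM-tree-decomposition. -/
noncomputable def TDMDecomp.width {G : MGraph} {γ : G.E → ZMod 2} {K : Set G.V}
    (D : TDMDecomp G γ K) : ℕ :=
  ⨆ t : D.ι, ((D.prot t).ncard + G.OCPOn γ (D.bag t \ D.prot t))

/-- The TDM-treewidth of a rooted signed graph. -/
noncomputable def TDMtw (G : MGraph) (γ : G.E → ZMod 2) (K : Set G.V) : ℕ :=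
  sInf {w | ∃ D : TDMDecomp G γ K, D.width = w}

/-! ## Grids, parity handles, parity vortices -/

/-- Adjacency of the grid, on `ℕ × ℕ` coordinates. -/
def gridAdj (a b : ℕ × ℕ) : Prop :=
  (a.1 = b.1 ∧ (a.2 + 1 = b.2 ∨ b.2 + 1 = a.2)) ∨
  (a.2 = b.2 ∧ (a.1 + 1 = b.1 ∨ b.1 + 1 = a.1))

/-- The `k × k` grid. -/
def gridGraph (k : ℕ) : MGraph where
  V := Fin k × Fin k
  E := {e : Sym2 (Fin k × Fin k) //
    ∃ a b : Fin k × Fin k, gridAdj (a.1.1, a.2.1) (b.1.1, b.2.1) ∧ e = s(a, b)}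
  finV := inferInstance
  finE := inferInstance
  ends := Subtype.val
  loopless := fun e he => by
    obtain ⟨a, b, hab, h⟩ := e.2
    rw [h, Sym2.mk_isDiag_iff] at he
    subst he
    rcases hab with ⟨_, h' | h'⟩ | ⟨_, h' | h'⟩ <;> omega

/-- The first row of the `k × k` grid. -/
def firstRow (k : ℕ) : Set (gridGraph k).V := {p : Fin k × Fin k | p.1.1 = 0}

/-- The `i`-th designated vertex `x_i` on the outer face of the cylindrical
`(k × 4k)`-grid (every other vertex, `0`-indexed). -/
def xvtx (k : ℕ) (i : Fin (2 * k)) : Fin k × Fin (4 * k) :=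
  (⟨0, by have := i.2; omega⟩, ⟨2 * i.1, by have := i.2; omega⟩)

/-- Adjacency of the cylindrical `(k × 4k)`-grid `P_k □ C_{4k}`. -/
def cylAdj (k : ℕ) (a b : Fin k × Fin (4 * k)) : Prop :=
  (a.1 = b.1 ∧ (a.2.1 + 1 = b.2.1 ∨ b.2.1 + 1 = a.2.1 ∨
    (a.2.1 = 0 ∧ b.2.1 + 1 = 4 * k) ∨ (b.2.1 = 0 ∧ a.2.1 + 1 = 4 * k))) ∨
  (a.2 = b.2 ∧ (a.1.1 + 1 = b.1.1 ∨ b.1.1 + 1 = a.1.1))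

/-- The chords `x_i x_{2k-i+1}` of the parity handle. -/
def handleChord (k : ℕ) (e : Sym2 (Fin k × Fin (4 * k))) : Prop :=
  ∃ i : Fin k, e = s(xvtx k ⟨i.1, by have := i.2; omega⟩,
    xvtx k ⟨2 * k - 1 - i.1, by have := i.2; omega⟩)

/-- The chords `x_{2i-1} x_{2i}` of the parity vortex. -/
def vortexChord (k : ℕ) (e : Sym2 (Fin k × Fin (4 * k))) : Prop :=
  ∃ i : Fin k, e = s(xvtx k ⟨2 * i.1, by have := i.2; omega⟩,
    xvtx k ⟨2 * i.1 + 1, by have := i.2; omega⟩)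

lemma xvtx_ne (k : ℕ) (i j : Fin (2 * k)) (h : i.1 ≠ j.1) : xvtx k i ≠ xvtx k j := by
  intro hc
  have := congrArg (fun p => p.2.1) hc
  simp only [xvtx] at this
  omega

/-- The unsigned, unrooted parity handle `H_k`. -/
def handleGraph (k : ℕ) : MGraph where
  V := Fin k × Fin (4 * k)
  E := {e : Sym2 (Fin k × Fin (4 * k)) //
    (∃ a b, cylAdj k a b ∧ e = s(a, b)) ∨ handleChord k e}
  finV := inferInstance
  finE := inferInstance
  ends := Subtype.val
  loopless := fun e he => by
    rcases e.2 with ⟨a, b, hab, h⟩ | ⟨i, h⟩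
    · rw [h, Sym2.mk_isDiag_iff] at he
      subst he
      have h1 := a.1.2
      have h2 := a.2.2
      rcases hab with ⟨_, h' | h' | ⟨h', h''⟩ | ⟨h', h''⟩⟩ | ⟨_, h' | h'⟩ <;> omega
    · rw [h, Sym2.mk_isDiag_iff] at he
      have := i.2
      exact xvtx_ne k _ _ (show (i.1 : ℕ) ≠ 2 * k - 1 - i.1 by omega) he

/-- The unsigned, unrooted parity vortex `V_k`. -/
def vortexGraph (k : ℕ) : MGraph where
  V := Fin k × Fin (4 * k)
  E := {e : Sym2 (Fin k × Fin (4 * k)) //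
    (∃ a b, cylAdj k a b ∧ e = s(a, b)) ∨ vortexChord k e}
  finV := inferInstance
  finE := inferInstance
  ends := Subtype.val
  loopless := fun e he => by
    rcases e.2 with ⟨a, b, hab, h⟩ | ⟨i, h⟩
    · rw [h, Sym2.mk_isDiag_iff] at he
      subst he
      have h1 := a.1.2
      have h2 := a.2.2
      rcases hab with ⟨_, h' | h' | ⟨h', h''⟩ | ⟨h', h''⟩⟩ | ⟨_, h' | h'⟩ <;> omega
    · rw [h, Sym2.mk_isDiag_iff] at he
      have := i.2
      exact xvtx_ne k _ _ (show (2 * i.1 : ℕ) ≠ 2 * i.1 + 1 by omega) he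

/-- The all-zero signing. -/
def γ₀ (G : MGraph) : G.E → ZMod 2 := fun _ => 0

/-- The all-one signing. -/
def γ₁ (G : MGraph) : G.E → ZMod 2 := fun _ => 1

/-! ## Matrices with two nonzero entries per row -/

/-- `A` has exactly two nonzero entries in every row. -/
def TwoNonzeroPerRow {m n : ℕ} (A : Matrix (Fin m) (Fin n) ℤ) : Prop :=
  ∀ i, {j | A i j ≠ 0}.ncard = 2

/-- The graph `G(A)` of a matrix with exactly two nonzero entries per row:
vertices are columns, edges are rows, each row joining its two nonzero columns. -/
noncomputable def matrixGraph {m n : ℕ} (A : Matrix (Fin m) (Fin n) ℤ)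
    (h : TwoNonzeroPerRow A) : MGraph where
  V := Fin n
  E := Fin m
  finV := inferInstance
  finE := inferInstance
  ends := fun i => s((Set.ncard_eq_two.mp (h i)).choose,
    (Set.ncard_eq_two.mp (h i)).choose_spec.choose)
  loopless := fun i hi => by
    rw [Sym2.mk_isDiag_iff] at hi
    exact (Set.ncard_eq_two.mp (h i)).choose_spec.choose_spec.1 hi

/-- The signing of `G(A)`: a row is even iff its two nonzero entries have
different signs (i.e. the product of its nonzero entries is negative). -/
def matrixSign {m n : ℕ} (A : Matrix (Fin m) (Fin n) ℤ) : Fin m → ZMod 2 :=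
  fun i => if (∏ j ∈ Finset.univ.filter (fun j => A i j ≠ 0), A i j) < 0 then 0 else 1

/-- The roots of `G⁺_•(A)`: columns containing an entry outside `{-1,0,1}`. -/
def matrixRoots {m n : ℕ} (A : Matrix (Fin m) (Fin n) ℤ) : Set (Fin n) :=
  {j | ∃ i, 1 < (A i j).natAbs}

/-- The TDM-treewidth of the rooted signed graph `G⁺_•(A)` associated to `A`. -/
noncomputable def matrixTDMtw {m n : ℕ} (A : Matrix (Fin m) (Fin n) ℤ)
    (h : TwoNonzeroPerRow A) : ℕ :=
  TDMtw (matrixGraph A h) (fun e => matrixSign A e) (fun j => matrixRoots A j)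

/-- The largest absolute value of an entry of `A`. -/
def maxAbsEntry {m n : ℕ} (A : Matrix (Fin m) (Fin n) ℤ) : ℕ :=
  Finset.sup Finset.univ fun i => Finset.sup Finset.univ fun j => (A i j).natAbs

/-- `A` is totally `Δ`-modular: every square subdeterminant has absolute value at
most `Δ`. -/
def TotallyDeltaModular {m n : ℕ} (A : Matrix (Fin m) (Fin n) ℤ) (Δ : ℕ) : Prop :=
  ∀ (s : ℕ) (r : Fin s → Fin m) (c : Fin s → Fin n),
    Function.Injective r → Function.Injective c →
    ((A.submatrix r c).det).natAbs ≤ Δ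

/-- The set of objective values of feasible points of the integer program
`max { wᵀx : Ax ≤ b, ℓ ≤ x ≤ u, x integral }`. -/
def IPvalues {m n : ℕ} (A : Matrix (Fin m) (Fin n) ℤ) (b : Fin m → ℤ)
    (w ℓ u : Fin n → ℤ) : Set ℤ :=
  {y | ∃ x : Fin n → ℤ, (∀ i, ∑ j, A i j * x j ≤ b i) ∧
    (∀ j, ℓ j ≤ x j ∧ x j ≤ u j) ∧ y = ∑ j, w j * x j}

/-- `o` solves the maximization problem over `S`: it is `none` iff `S` is
infeasible, and otherwise it is the maximum value. -/
def SolvesIP (o : Option ℤ) (S : Set ℤ) : Prop :=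
  (o = none ∧ S = ∅) ∨ ∃ y, o = some y ∧ IsGreatest S y


lemma exists_pair {α : Type} (z : Sym2 α) : ∃ p : α × α, z = s(p.1, p.2) :=
  Sym2.ind (fun a b => ⟨(a, b), rfl⟩) z

/-- A chosen first endpoint of an edge. -/
noncomputable def MGraph.ep1 (G : MGraph) (e : G.E) : G.V :=
  (exists_pair (G.ends e)).choose.1

/-- A chosen second endpoint of an edge. -/
noncomputable def MGraph.ep2 (G : MGraph) (e : G.E) : G.V :=
  (exists_pair (G.ends e)).choose.2

lemma MGraph.ends_ep (G : MGraph) (e : G.E) : G.ends e = s(G.ep1 e, G.ep2 e) :=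
  (exists_pair (G.ends e)).choose_spec

lemma map_inl_not_isDiag {α β : Type} (z : Sym2 α) (hz : ¬ z.IsDiag) :
    ¬ (z.map (Sum.inl : α → α ⊕ β)).IsDiag := by
  induction z using Sym2.ind with
  | _ a b =>
    simp only [Sym2.map_pair_eq, Sym2.mk_isDiag_iff] at *
    exact fun h => hz (by injection h)

/-- The graph obtained from `(G,γ)` by subdividing every even edge exactly once. -/
noncomputable def subdivideEven (G : MGraph) (γ : G.E → ZMod 2) : MGraph where
  V := G.V ⊕ {e : G.E // γ e = 0}
  E := {e : G.E // γ e ≠ 0} ⊕ ({e : G.E // γ e = 0} × Bool)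
  finV := inferInstance
  finE := inferInstance
  ends := fun x =>
    match x with
    | .inl e => (G.ends e.1).map .inl
    | .inr (e, b) => s(.inr e, .inl (if b then G.ep1 e.1 else G.ep2 e.1))
  loopless := fun x => by
    match x with
    | .inl e => exact map_inl_not_isDiag _ (G.loopless e.1)
    | .inr (e, b) =>
      rw [Sym2.mk_isDiag_iff]
      simp

/-- Minimum degree at least `d` (each vertex is incident to at least `d` edges). -/
def minDegreeGE (G : MGraph) (d : ℕ) : Prop :=
  ∀ v : G.V, d ≤ {e : G.E | v ∈ G.ends e}.ncard

/-- The `j`-th vertex of the subdividing path: `u`, then `ℓ` new internal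
vertices, then `v`. -/
def pathVert {α : Type} (u v : α) (ℓ : ℕ) (j : Fin (ℓ + 2)) : α ⊕ Fin ℓ :=
  if h0 : j.1 = 0 then .inl u
  else if h1 : j.1 = ℓ + 1 then .inl v
  else .inr ⟨j.1 - 1, by have := j.2; omega⟩

/-- The graph obtained from `G` by replacing the edge `e₀` (with ends `u,v`) by a
path with `ℓ` internal vertices (hence `ℓ + 1` edges). -/
def replaceEdge (G : MGraph) (e₀ : G.E) (u v : G.V) (h : G.ends e₀ = s(u, v))
    (ℓ : ℕ) : MGraph where
  V := G.V ⊕ Fin ℓ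
  E := {e : G.E // e ≠ e₀} ⊕ Fin (ℓ + 1)
  finV := inferInstance
  finE := inferInstance
  ends := fun x =>
    match x with
    | .inl e => (G.ends e.1).map .inl
    | .inr i => s(pathVert u v ℓ ⟨i.1, by have := i.2; omega⟩,
        pathVert u v ℓ ⟨i.1 + 1, by have := i.2; omega⟩)
  loopless := fun x => by
    match x with
    | .inl e => exact map_inl_not_isDiag _ (G.loopless e.1)
    | .inr i =>
      rw [Sym2.mk_isDiag_iff]
      have huv : u ≠ v := by
        intro hc
        exact G.loopless e₀ (by rw [h, hc]; simp)
      have hi := i.2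
      simp only [pathVert]
      split_ifs <;> (simp_all; try omega)

/-- The signing of `replaceEdge`: old edges keep their sign, the `i`-th path edge
gets sign `δ i`. -/
def replaceGamma {G : MGraph} {e₀ : G.E} {u v : G.V} {h : G.ends e₀ = s(u, v)}
    {ℓ : ℕ} (γ : G.E → ZMod 2) (δ : Fin (ℓ + 1) → ZMod 2) :
    (replaceEdge G e₀ u v h ℓ).E → ZMod 2 :=
  fun x => match x with
  | .inl e => γ e.1
  | .inr i => δ i


/-! ## Proof -/

lemma rtg_mono {α : Type} {r s : α → α → Prop} {a b : α} (h : ∀ x y, r x y → s x y)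
    (hab : Relation.ReflTransGen r a b) : Relation.ReflTransGen s a b := by
  induction hab with
  | refl => exact .refl
  | tail _ h1 ih => exact ih.tail (h _ _ h1)

lemma ends_shift (G : MGraph) (γ : G.E → ZMod 2) (σ : G.V → ZMod 2) (e : G.E) (u v : G.V)
    (h : G.ends e = s(u, v)) :
    γ e + σ (G.ep1 e) + σ (G.ep2 e) = γ e + σ u + σ v := by
  have h2 := G.ends_ep e
  rw [h, Sym2.eq_iff] at h2
  rcases h2 with ⟨h1, h2⟩ | ⟨h1, h2⟩
  · rw [h1, h2]
  · rw [h1, h2]; ring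

/-- One step along an edge that is even after shifting by `σ`, inside `S`. -/
def EStep (G : MGraph) (γ : G.E → ZMod 2) (σ : G.V → ZMod 2) (S : Set G.V) (x y : G.V) : Prop :=
  x ∈ S ∧ y ∈ S ∧ ∃ e, γ e + σ x + σ y = 0 ∧ G.ends e = s(x, y)

lemma EStep.symm {G : MGraph} {γ : G.E → ZMod 2} {σ : G.V → ZMod 2} {S : Set G.V} {x y : G.V}
    (h : EStep G γ σ S x y) : EStep G γ σ S y x := by
  obtain ⟨hx, hy, e, h0, he⟩ := h
  exact ⟨hy, hx, e, by rw [← h0]; ring, by rw [he, Sym2.eq_swap]⟩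

lemma EStep.rsymm {G : MGraph} {γ : G.E → ZMod 2} {σ : G.V → ZMod 2} {S : Set G.V} {x y : G.V}
    (h : Relation.ReflTransGen (EStep G γ σ S) x y) :
    Relation.ReflTransGen (EStep G γ σ S) y x := by
  induction h with
  | refl => exact .refl
  | tail _ h ih => exact .head h.symm ih

lemma mkModel (H G : MGraph) (hinj : Function.Injective H.ends) (γH : H.E → ZMod 2)
    (γ : G.E → ZMod 2) (σ : G.V → ZMod 2) (bs : H.V → Set G.V) (base : H.V → G.V)
    (hb : ∀ v, base v ∈ bs v)
    (hdisj : ∀ u v x, x ∈ bs u → x ∈ bs v → u = v)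
    (hconn : ∀ v, ∀ b ∈ bs v, Relation.ReflTransGen (EStep G γ σ (bs v)) (base v) b)
    (hedge : ∀ eH, ∃ u v a b e, H.ends eH = s(u, v) ∧ a ∈ bs u ∧ b ∈ bs v ∧
      G.ends e = s(a, b) ∧ γ e + σ a + σ b = γH eH) :
    ∃ M : SignedMinorModel H G γH γ, M.bs = bs := by
  choose fu fv fa fb fe h1 h2 h3 h4 h5 using hedge
  refine ⟨⟨fun e => γ e + σ (G.ep1 e) + σ (G.ep2 e), ⟨σ, fun e u v h => ends_shift G γ σ e u v h⟩,
    bs, fe, fun v => ⟨_, hb v⟩, ?_, ?_, ?_, ?_, ?_⟩, rfl⟩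
  · intro u v huv
    rw [Set.disjoint_left]
    intro x hx hx'
    exact huv (hdisj u v x hx hx')
  · intro v a ha b hb'
    have := (EStep.rsymm (hconn v a ha)).trans (hconn v b hb')
    refine rtg_mono ?_ this
    rintro x y ⟨hx, hy, e, h0, he⟩
    exact ⟨hx, hy, e, by rw [ends_shift G γ σ e x y he, h0], he⟩
  · intro e e' hee
    apply hinj
    have h := h4 e
    rw [hee, h4 e', Sym2.eq_iff] at h
    rw [h1, h1 e']
    rcases h with ⟨ha, hb⟩ | ⟨ha, hb⟩
    · rw [hdisj (fu e) (fu e') _ (h2 e) (ha ▸ h2 e'), hdisj (fv e) (fv e') _ (h3 e) (hb ▸ h3 e')]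
    · rw [hdisj (fu e) (fv e') _ (h2 e) (hb ▸ h3 e'), hdisj (fv e) (fu e') _ (h3 e) (ha ▸ h2 e'),
        Sym2.eq_swap]
  · intro eH u v h
    rw [h1 eH, Sym2.eq_iff] at h
    rcases h with ⟨ha, hb⟩ | ⟨ha, hb⟩
    · exact ⟨fa eH, ha ▸ h2 eH, fb eH, hb ▸ h3 eH, h4 eH⟩
    · exact ⟨fb eH, hb ▸ h3 eH, fa eH, ha ▸ h2 eH, by rw [h4, Sym2.eq_swap]⟩
  · intro eH
    show γ (fe eH) + σ _ + σ _ = _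
    rw [ends_shift G γ σ _ _ _ (h4 eH), h5]

/-- A potential making a connected set connected through even edges. -/
lemma exists_potential (G : MGraph) (γ : G.E → ZMod 2) (S : Set G.V) (a : G.V) (ha : a ∈ S)
    (hS : ∀ b ∈ S, Relation.ReflTransGen
      (fun x y => x ∈ S ∧ y ∈ S ∧ ∃ e, G.ends e = s(x, y)) a b) :
    ∃ σ : G.V → ZMod 2, ∀ b ∈ S, Relation.ReflTransGen (EStep G γ σ S) a b := by
  classical
  let F : Set (Set G.V) := {T | a ∈ T ∧ T ⊆ S ∧ ∃ σ : G.V → ZMod 2, ∀ b ∈ T,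
    Relation.ReflTransGen (EStep G γ σ T) a b}
  have hF : F.Nonempty := ⟨{a}, rfl, by simpa using ha, 0, by
    rintro b rfl; exact .refl⟩
  obtain ⟨T, hT⟩ := (Set.toFinite F).exists_maximal hF
  obtain ⟨⟨haT, hTS, σ, hσ⟩, hmax⟩ := hT
  have hcl : ∀ b, Relation.ReflTransGen
      (fun x y => x ∈ S ∧ y ∈ S ∧ ∃ e, G.ends e = s(x, y)) a b → b ∈ T := by
    intro b hb
    induction hb with
    | refl => exact haT
    | @tail x y _ hxy ih =>
      obtain ⟨hx, hy, e, he⟩ := hxy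
      by_contra hyT
      let σ' := Function.update σ y (γ e + σ x)
      have hne : ∀ z ∈ T, σ' z = σ z := fun z hz =>
        Function.update_of_ne (fun h : z = y => hyT (h ▸ hz)) _ _
      have hold : ∀ b ∈ T, Relation.ReflTransGen (EStep G γ σ' (insert y T)) a b := by
        intro b hb
        refine rtg_mono ?_ (hσ b hb)
        rintro p q ⟨hp, hq, e, h0, he⟩
        exact ⟨.inr hp, .inr hq, e, by rw [hne p hp, hne q hq, h0], he⟩
      have : insert y T ∈ F := by
        refine ⟨.inr haT, Set.insert_subset hy hTS, σ', ?_⟩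
        rintro b (rfl | hb)
        · refine (hold x ih).tail ⟨.inr ih, .inl rfl, e, ?_, he⟩
          have : σ' b = γ e + σ x := Function.update_self _ _ _
          rw [this, hne x ih]
          exact CharTwo.add_self_eq_zero _
        · exact hold b hb
      exact hyT (hmax this (Set.subset_insert _ _) (Set.mem_insert _ _))
  have hTS' : T = S := Set.Subset.antisymm hTS fun b hb => hcl b (hS b hb)
  subst hTS'
  exact ⟨σ, hσ⟩

lemma signed_of_minor (H : MGraph) (KH : Set H.V) (G : MGraph) (KG : Set G.V)
    (γ : G.E → ZMod 2) (h : IsRootedMinor H KH G KG) :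
    ∃ γH, IsRootedSignedMinor H γH KH G γ KG := by
  classical
  obtain ⟨M, hM⟩ := h
  choose base hbase using M.bs_nonempty
  choose τ hτ using fun v => exists_potential G γ (M.bs v) (base v) (hbase v)
    (M.bs_connected v (base v) (hbase v))
  let σ : G.V → ZMod 2 := fun x => if h : ∃ v, x ∈ M.bs v then τ h.choose x else 0
  have hσ : ∀ v, ∀ x ∈ M.bs v, σ x = τ v x := by
    intro v x hx
    have hex : ∃ v, x ∈ M.bs v := ⟨v, hx⟩
    have : hex.choose = v := by
      by_contra hne
      exact Set.disjoint_left.1 (M.bs_disjoint _ _ hne) hex.choose_spec hx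
    show (if h : ∃ v, x ∈ M.bs v then τ h.choose x else 0) = _
    rw [dif_pos hex, this]
  have hconn : ∀ v, ∀ b ∈ M.bs v, Relation.ReflTransGen (EStep G γ σ (M.bs v)) (base v) b := by
    intro v b hb
    refine rtg_mono ?_ (hτ v b hb)
    rintro x y ⟨hx, hy, e, h0, he⟩
    exact ⟨hx, hy, e, by rw [hσ v x hx, hσ v y hy, h0], he⟩
  let γ' : G.E → ZMod 2 := fun e => γ e + σ (G.ep1 e) + σ (G.ep2 e)
  refine ⟨fun e => γ' (M.em e), ⟨⟨γ', ⟨σ, fun e u v h => ends_shift G γ σ e u v h⟩, M.bs, M.em,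
    M.bs_nonempty, M.bs_disjoint, ?_, M.em_inj, M.em_ends, fun _ => rfl⟩, hM⟩⟩
  intro v a ha b hb
  refine rtg_mono ?_ ((EStep.rsymm (hconn v a ha)).trans (hconn v b hb))
  rintro x y ⟨hx, hy, e, h0, he⟩
  exact ⟨hx, hy, e, (ends_shift G γ σ e x y he).trans h0, he⟩

lemma signed_trans (A B C : MGraph) (KA : Set A.V) (KB : Set B.V) (KC : Set C.V)
    (γA : A.E → ZMod 2) (γB : B.E → ZMod 2) (γC : C.E → ZMod 2)
    (h1 : IsRootedSignedMinor A γA KA B γB KB) (h2 : IsRootedSignedMinor B γB KB C γC KC) :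
    IsRootedSignedMinor A γA KA C γC KC := by
  classical
  obtain ⟨M, hM⟩ := h1
  obtain ⟨N, hN⟩ := h2
  obtain ⟨σ, hσ⟩ := M.shift
  obtain ⟨τ, hτ⟩ := N.shift
  let ρ : C.V → ZMod 2 := fun x => if h : ∃ v, x ∈ N.bs v then σ h.choose else 0
  have hρ : ∀ v, ∀ x ∈ N.bs v, ρ x = σ v := by
    intro v x hx
    have hex : ∃ v, x ∈ N.bs v := ⟨v, hx⟩
    have : hex.choose = v := by
      by_contra hne
      exact Set.disjoint_left.1 (N.bs_disjoint _ _ hne) hex.choose_spec hx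
    show (if h : ∃ v, x ∈ N.bs v then σ h.choose else 0) = _
    rw [dif_pos hex, this]
  let γ' : C.E → ZMod 2 := fun e => N.γ' e + ρ (C.ep1 e) + ρ (C.ep2 e)
  have hγ' : ∀ e u v, C.ends e = s(u, v) → γ' e = N.γ' e + ρ u + ρ v :=
    fun e u v h => ends_shift C N.γ' ρ e u v h
  have hem : ∀ e, γ' (N.em e) = M.γ' e := by
    intro e
    obtain ⟨a, ha, b, hb, hab⟩ := N.em_ends e _ _ (B.ends_ep e)
    rw [hγ' _ _ _ hab, hρ _ _ ha, hρ _ _ hb, N.em_parity, hσ _ _ _ (B.ends_ep e)]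
  let bs : A.V → Set C.V := fun v => {x | ∃ y ∈ M.bs v, x ∈ N.bs y}
  have hin : ∀ v, ∀ y ∈ M.bs v, ∀ a ∈ N.bs y, ∀ b ∈ N.bs y, Relation.ReflTransGen
      (fun x y => x ∈ bs v ∧ y ∈ bs v ∧ ∃ e, γ' e = 0 ∧ C.ends e = s(x, y)) a b := by
    intro v y hy a ha b hb
    refine rtg_mono ?_ (N.bs_connected y a ha b hb)
    rintro p q ⟨hp, hq, e, h0, he⟩
    refine ⟨⟨y, hy, hp⟩, ⟨y, hy, hq⟩, e, ?_, he⟩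
    rw [hγ' _ _ _ he, hρ _ _ hp, hρ _ _ hq, h0, zero_add]
    exact CharTwo.add_self_eq_zero _
  refine ⟨⟨γ', ⟨fun x => τ x + ρ x, ?_⟩, bs, fun e => N.em (M.em e), ?_, ?_, ?_,
    N.em_inj.comp M.em_inj, ?_, ?_⟩, ?_⟩
  · intro e u v h
    rw [hγ' _ _ _ h, hτ _ _ _ h]; ring
  · intro v
    obtain ⟨y, hy⟩ := M.bs_nonempty v
    obtain ⟨x, hx⟩ := N.bs_nonempty y
    exact ⟨x, y, hy, hx⟩
  · intro u v huv
    rw [Set.disjoint_left]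
    rintro x ⟨y, hy, hx⟩ ⟨y', hy', hx'⟩
    have : y = y' := by
      by_contra hne
      exact Set.disjoint_left.1 (N.bs_disjoint _ _ hne) hx hx'
    subst this
    exact Set.disjoint_left.1 (M.bs_disjoint _ _ huv) hy hy'
  · rintro v a ⟨y, hy, ha⟩ b ⟨y', hy', hb⟩
    have key : ∀ z, Relation.ReflTransGen
      (fun x y => x ∈ M.bs v ∧ y ∈ M.bs v ∧ ∃ e, M.γ' e = 0 ∧ B.ends e = s(x, y)) y z →
      z ∈ M.bs v ∧ ∀ b ∈ N.bs z, Relation.ReflTransGen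
      (fun x y => x ∈ bs v ∧ y ∈ bs v ∧ ∃ e, γ' e = 0 ∧ C.ends e = s(x, y)) a b := by
      intro z hz
      induction hz with
      | refl => exact ⟨hy, fun b hb => hin v y hy a ha b hb⟩
      | @tail p q _ hpq ih =>
        obtain ⟨hp, hq, e, h0, he⟩ := hpq
        obtain ⟨c, hc, d, hd, hcd⟩ := N.em_ends e _ _ he
        refine ⟨hq, fun b hb => ?_⟩
        refine ((ih.2 c hc).tail ?_).trans (hin v q hq d hd b hb)
        exact ⟨⟨p, hp, hc⟩, ⟨q, hq, hd⟩, N.em e, by rw [hem, h0], hcd⟩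
    exact (key y' (M.bs_connected v y hy y' hy')).2 b hb
  · intro eA u v h
    obtain ⟨a, ha, b, hb, hab⟩ := M.em_ends eA u v h
    obtain ⟨c, hc, d, hd, hcd⟩ := N.em_ends _ a b hab
    exact ⟨c, ⟨a, ha, hc⟩, d, ⟨b, hb, hd⟩, hcd⟩
  · intro eA
    show γ' (N.em (M.em eA)) = _
    rw [hem, M.em_parity]
  · intro v hv
    obtain ⟨y, hy, hyK⟩ := hM v hv
    obtain ⟨x, hx, hxK⟩ := hN y hyK
    exact ⟨x, ⟨y, hy, hx⟩, hxK⟩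

/-- Grid vertex with natural number coordinates. -/
def gv (n r c : ℕ) (hr : r < n) (hc : c < n) : (gridGraph n).V :=
  ((⟨r, hr⟩, ⟨c, hc⟩) : Fin n × Fin n)

/-- Row coordinate. -/
def gr {n : ℕ} (x : (gridGraph n).V) : ℕ := (show Fin n × Fin n from x).1.1
/-- Column coordinate. -/
def gc {n : ℕ} (x : (gridGraph n).V) : ℕ := (show Fin n × Fin n from x).2.1

@[simp] lemma gr_gv (n r c : ℕ) (hr : r < n) (hc : c < n) : gr (gv n r c hr hc) = r := rfl
@[simp] lemma gc_gv (n r c : ℕ) (hr : r < n) (hc : c < n) : gc (gv n r c hr hc) = c := rfl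
lemma gr_lt {n : ℕ} (x : (gridGraph n).V) : gr x < n := (show Fin n × Fin n from x).1.2
lemma gc_lt {n : ℕ} (x : (gridGraph n).V) : gc x < n := (show Fin n × Fin n from x).2.2
lemma gv_eta {n : ℕ} (x : (gridGraph n).V) : gv n (gr x) (gc x) (gr_lt x) (gc_lt x) = x := rfl
lemma grid_ext {n : ℕ} (x y : (gridGraph n).V) (h1 : gr x = gr y) (h2 : gc x = gc y) : x = y :=
  Prod.ext (Fin.ext h1) (Fin.ext h2)
lemma eq_gv {n r c : ℕ} (x : (gridGraph n).V) (h1 : gr x = r) (h2 : gc x = c) :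
    x = gv n r c (h1 ▸ gr_lt x) (h2 ▸ gc_lt x) := grid_ext _ _ h1 h2

lemma grid_ends_inj (n : ℕ) : Function.Injective (gridGraph n).ends := Subtype.val_injective

lemma grid_edge_h (n r c : ℕ) (hr : r < n) (hc : c + 1 < n) :
    ∃ e, (gridGraph n).ends e = s(gv n r c hr (by omega), gv n r (c + 1) hr hc) :=
  ⟨⟨s(gv n r c hr (by omega), gv n r (c + 1) hr hc), gv n r c hr (by omega),
    gv n r (c + 1) hr hc, .inl ⟨rfl, .inl rfl⟩, rfl⟩, rfl⟩

lemma grid_edge_v (n r c : ℕ) (hr : r + 1 < n) (hc : c < n) :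
    ∃ e, (gridGraph n).ends e = s(gv n r c (by omega) hc, gv n (r + 1) c hr hc) :=
  ⟨⟨s(gv n r c (by omega) hc, gv n (r + 1) c hr hc), gv n r c (by omega) hc,
    gv n (r + 1) c hr hc, .inr ⟨rfl, .inl rfl⟩, rfl⟩, rfl⟩

lemma grid_edge_cases (n : ℕ) (e : (gridGraph n).E) :
    (∃ r c, ∃ (hr : r < n) (hc : c + 1 < n),
      (gridGraph n).ends e = s(gv n r c hr (by omega), gv n r (c + 1) hr hc)) ∨
    (∃ r c, ∃ (hr : r + 1 < n) (hc : c < n),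
      (gridGraph n).ends e = s(gv n r c (by omega) hc, gv n (r + 1) c hr hc)) := by
  obtain ⟨e, ⟨⟨a1, ha1⟩, ⟨a2, ha2⟩⟩, ⟨⟨b1, hb1⟩, ⟨b2, hb2⟩⟩, hab, rfl⟩ := e
  simp only [gridAdj] at hab
  rcases hab with ⟨h, h' | h'⟩ | ⟨h, h' | h'⟩
  · subst h h'; exact .inl ⟨_, _, ha1, hb2, rfl⟩
  · subst h h'; exact .inl ⟨_, _, ha1, ha2, Sym2.eq_swap⟩
  · subst h h'; exact .inr ⟨_, _, hb1, ha2, rfl⟩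
  · subst h h'; exact .inr ⟨_, _, ha1, ha2, Sym2.eq_swap⟩

/-- Gauge fixing: all horizontal edges even. -/
lemma gauge (n : ℕ) (γ : (gridGraph n).E → ZMod 2) :
    ∃ ρ w : ℕ → ℕ → ZMod 2,
      (∀ r c, ∀ (hr : r < n) (hc : c + 1 < n), ∃ e,
        (gridGraph n).ends e = s(gv n r c hr (by omega), gv n r (c + 1) hr hc) ∧
        γ e + ρ r c + ρ r (c + 1) = 0) ∧
      (∀ r c, ∀ (hr : r + 1 < n) (hc : c < n), ∃ e,
        (gridGraph n).ends e = s(gv n r c (by omega) hc, gv n (r + 1) c hr hc) ∧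
        γ e + ρ r c + ρ (r + 1) c = w r c) := by
  classical
  let h : ℕ → ℕ → ZMod 2 := fun r c =>
    if H : r < n ∧ c + 1 < n then γ (grid_edge_h n r c H.1 H.2).choose else 0
  let v : ℕ → ℕ → ZMod 2 := fun r c =>
    if H : r + 1 < n ∧ c < n then γ (grid_edge_v n r c H.1 H.2).choose else 0
  let ρ : ℕ → ℕ → ZMod 2 := fun r c => ∑ i ∈ Finset.range c, h r i
  refine ⟨ρ, fun r c => v r c + ρ r c + ρ (r + 1) c, ?_, ?_⟩
  · intro r c hr hc
    refine ⟨_, (grid_edge_h n r c hr hc).choose_spec, ?_⟩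
    have h1 : h r c = γ (grid_edge_h n r c hr hc).choose := dif_pos ⟨hr, hc⟩
    have h2 : ρ r (c + 1) = ρ r c + h r c := Finset.sum_range_succ _ _
    rw [h2, ← h1]
    generalize h r c = x
    generalize ρ r c = y
    revert x y; decide
  · intro r c hr hc
    refine ⟨_, (grid_edge_v n r c hr hc).choose_spec, ?_⟩
    have h1 : v r c = γ (grid_edge_v n r c hr hc).choose := dif_pos ⟨hr, hc⟩
    show _ = v r c + ρ r c + ρ (r + 1) c
    rw [h1]

lemma choose_columns (k : ℕ) (u : ℕ → ℕ → ZMod 2) (a c c' : ℕ) (ha : a < k - 1) (hc : c < k)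
    (hc' : c' < k) (hne : u a c ≠ u a c') (t : ZMod 2) :
    ∃ d : ℕ → ℕ, (∀ i, d i < k) ∧ ∑ i ∈ Finset.range (k - 1), u i (d i) = t := by
  classical
  have key : ∀ x, ∑ i ∈ Finset.range (k - 1), u i (if i = a then x else 0) =
      u a x + ∑ i ∈ (Finset.range (k - 1)).erase a, u i 0 := by
    intro x
    rw [← Finset.add_sum_erase _ _ (Finset.mem_range.2 ha), if_pos rfl]
    congr 1
    apply Finset.sum_congr rfl
    intro i hi
    rw [if_neg (Finset.ne_of_mem_erase hi)]
  have hd : ∀ p q s t : ZMod 2, p ≠ q → p + s = t ∨ q + s = t := by decide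
  rcases hd _ _ (∑ i ∈ (Finset.range (k - 1)).erase a, u i 0) t hne with h | h
  · exact ⟨fun i => if i = a then c else 0, fun i => by dsimp only; split_ifs <;> omega, by rw [key, h]⟩
  · exact ⟨fun i => if i = a then c' else 0, fun i => by dsimp only; split_ifs <;> omega, by rw [key, h]⟩

lemma blk_lt {k I i : ℕ} (hI : I < k) (hi : i < k) : I * k + i < k ^ 2 := by nlinarith

lemma blk_unique {k I i I' i' : ℕ} (hi : i < k) (hi' : i' < k) (h : I * k + i = I' * k + i') :
    I = I' ∧ i = i' := by
  have hk : 0 < k := by omega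
  have h1 : (I * k + i) / k = I := by
    rw [mul_comm, Nat.mul_add_div hk, Nat.div_eq_of_lt hi, add_zero]
  have h2 : (I' * k + i') / k = I' := by
    rw [mul_comm, Nat.mul_add_div hk, Nat.div_eq_of_lt hi', add_zero]
  have : I = I' := by rw [← h1, ← h2, h]
  subst this
  exact ⟨rfl, by omega⟩

lemma zz (a : ZMod 2) : a + a = 0 := CharTwo.add_self_eq_zero a

lemma grid_evenBlock (k : ℕ) (γ : (gridGraph (k ^ 2)).E → ZMod 2) (ρ w : ℕ → ℕ → ZMod 2)
    (hh : ∀ r c, ∀ (hr : r < k ^ 2) (hc : c + 1 < k ^ 2), ∃ e,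
        (gridGraph (k ^ 2)).ends e =
          s(gv (k ^ 2) r c hr (by omega), gv (k ^ 2) r (c + 1) hr hc) ∧
        γ e + ρ r c + ρ r (c + 1) = 0)
    (hv : ∀ r c, ∀ (hr : r + 1 < k ^ 2) (hc : c < k ^ 2), ∃ e,
        (gridGraph (k ^ 2)).ends e =
          s(gv (k ^ 2) r c (by omega) hc, gv (k ^ 2) (r + 1) c hr hc) ∧
        γ e + ρ r c + ρ (r + 1) c = w r c)
    (I J : ℕ) (hI : I < k) (hJ : J < k)
    (hev : ∀ a < k - 1, ∀ c < k, w (I * k + a) (J * k + c) = w (I * k + a) (J * k)) :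
    IsRootedSignedMinor (gridGraph k) (γ₀ (gridGraph k)) (firstRow k)
      (gridGraph (k ^ 2)) γ (firstRow (k ^ 2)) := by
  let π : ℕ → ℕ → ZMod 2 := fun r c =>
    ∑ i ∈ Finset.Ico r (I * k), w i c + ∑ i ∈ Finset.Ico (I * k) r, w i (J * k)
  have hπ0 : ∀ r c c', I * k ≤ r → π r c = π r c' := by
    intro r c c' h
    simp only [π, Finset.Ico_eq_empty_of_le h]
    simp
  have hπ1 : ∀ r c, r < I * k → w r c + π r c + π (r + 1) c = 0 := by
    intro r c h
    simp only [π, Finset.Ico_eq_empty_of_le (show r ≤ I * k by omega),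
      Finset.Ico_eq_empty_of_le (show r + 1 ≤ I * k by omega), Finset.sum_eq_sum_Ico_succ_bot h,
      Finset.sum_empty, add_zero]
    rw [← add_assoc, zz, zero_add, zz]
  have hπ2 : ∀ a c, a < k - 1 → c < k →
      w (I * k + a) (J * k + c) + π (I * k + a) (J * k + c) + π (I * k + a + 1) (J * k + c) = 0 := by
    intro a c ha hc
    simp only [π, Finset.Ico_eq_empty_of_le (show I * k ≤ I * k + a by omega),
      Finset.Ico_eq_empty_of_le (show I * k ≤ I * k + a + 1 by omega),
      Finset.sum_Ico_succ_top (show I * k ≤ I * k + a by omega), Finset.sum_empty, zero_add]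
    rw [hev a ha c hc, add_comm (w _ _), add_assoc, add_comm (w _ _), add_assoc, zz, add_zero, zz]
  let σ : (gridGraph (k ^ 2)).V → ZMod 2 := fun x => ρ (gr x) (gc x) + π (gr x) (gc x)
  let bs : (gridGraph k).V → Set (gridGraph (k ^ 2)).V := fun p =>
    {x | gc x = J * k + gc p ∧ (gr x = I * k + gr p ∨ (gr p = 0 ∧ gr x ≤ I * k))}
  let base : (gridGraph k).V → (gridGraph (k ^ 2)).V := fun p =>
    gv (k ^ 2) (I * k + gr p) (J * k + gc p) (blk_lt hI (gr_lt p)) (blk_lt hJ (gc_lt p))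
  have hbase : ∀ p, base p ∈ bs p := fun p => ⟨rfl, .inl rfl⟩
  have ar : ∀ g r1 r2 p1 p2 x : ZMod 2, g + r1 + r2 = x → x + p1 + p2 = 0 →
      g + (r1 + p1) + (r2 + p2) = 0 := by decide
  refine Exists.elim (mkModel (gridGraph k) (gridGraph (k ^ 2)) (grid_ends_inj k)
    (γ₀ (gridGraph k)) γ σ bs base hbase ?_ ?_ ?_) ?_
  rotate_left 3
  · intro M hM
    refine ⟨M, fun p hp => ?_⟩
    rw [hM]
    have hp0 : gr p = 0 := hp
    exact ⟨gv (k ^ 2) 0 (J * k + gc p) (by have := blk_lt hI hI; omega) (blk_lt hJ (gc_lt p)),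
      ⟨rfl, .inr ⟨hp0, Nat.zero_le _⟩⟩, rfl⟩
  · rintro u v x ⟨h1, h2⟩ ⟨h3, h4⟩
    apply grid_ext
    · omega
    · omega
  · intro p x hx
    have up : gr p = 0 → ∀ m, ∀ x, gc x = J * k + gc p → gr x + m = I * k →
        Relation.ReflTransGen (EStep (gridGraph (k ^ 2)) γ σ (bs p)) (base p) x := by
      intro hp m
      induction m with
      | zero =>
        intro x h1 h2
        have : x = base p := grid_ext _ _ (by simp [base]; omega) (by simp [base]; omega)
        rw [this]
      | succ m ih =>
        intro x h1 h2
        have hlt : gr x + 1 < k ^ 2 := by have := blk_lt hI hI; omega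
        let y := gv (k ^ 2) (gr x + 1) (gc x) hlt (gc_lt x)
        refine (ih y (by simpa [y] using h1) (by simp [y]; omega)).tail (EStep.symm ?_)
        obtain ⟨e, he, h0⟩ := hv (gr x) (gc x) hlt (gc_lt x)
        refine ⟨⟨h1, .inr ⟨hp, by omega⟩⟩, ⟨h1, .inr ⟨hp, by simp [y]; omega⟩⟩, e, ?_, he⟩
        exact ar _ _ _ _ _ _ h0 (hπ1 _ _ (by omega))
    obtain ⟨h1, h2 | ⟨h2, h3⟩⟩ := hx
    · have : x = base p := grid_ext _ _ (by simpa [base] using h2) (by simpa [base] using h1)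
      rw [this]
    · exact up h2 (I * k - gr x) x h1 (by omega)
  · intro eH
    rcases grid_edge_cases k eH with ⟨r, c, hr, hc, he⟩ | ⟨r, c, hr, hc, he⟩
    · obtain ⟨e, he', h0⟩ := hh (I * k + r) (J * k + c) (blk_lt hI hr) (blk_lt hJ hc)
      refine ⟨_, _, _, _, e, he, hbase _, hbase _, he', ?_⟩
      refine ar _ _ _ _ _ _ h0 ?_
      simp only [base, gr_gv, gc_gv, zero_add]
      rw [hπ0 _ (J * k + c) (J * k + (c + 1)) (by omega), zz]
    · obtain ⟨e, he', h0⟩ := hv (I * k + r) (J * k + c) (blk_lt hI hr) (blk_lt hJ hc)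
      refine ⟨_, _, _, _, e, he, hbase _, hbase _, he', ?_⟩
      exact ar _ _ _ _ _ _ h0 (hπ2 r c (by omega) hc)

lemma grid_oddBlocks (k : ℕ) (γ : (gridGraph (k ^ 2)).E → ZMod 2) (ρ w : ℕ → ℕ → ZMod 2)
    (hh : ∀ r c, ∀ (hr : r < k ^ 2) (hc : c + 1 < k ^ 2), ∃ e,
        (gridGraph (k ^ 2)).ends e =
          s(gv (k ^ 2) r c hr (by omega), gv (k ^ 2) r (c + 1) hr hc) ∧
        γ e + ρ r c + ρ r (c + 1) = 0)
    (hv : ∀ r c, ∀ (hr : r + 1 < k ^ 2) (hc : c < k ^ 2), ∃ e,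
        (gridGraph (k ^ 2)).ends e =
          s(gv (k ^ 2) r c (by omega) hc, gv (k ^ 2) (r + 1) c hr hc) ∧
        γ e + ρ r c + ρ (r + 1) c = w r c)
    (hodd : ∀ I J, I < k → J < k →
      ∃ a < k - 1, ∃ c < k, w (I * k + a) (J * k + c) ≠ w (I * k + a) (J * k)) :
    IsRootedSignedMinor (gridGraph k) (γ₀ (gridGraph k)) (firstRow k)
      (gridGraph (k ^ 2)) γ (firstRow (k ^ 2)) := by
  have hd : ∀ I J, ∃ d : ℕ → ℕ, I < k → J < k → (∀ i, d i < k) ∧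
      ∑ i ∈ Finset.range (k - 1), w (I * k + i) (J * k + d i) = w (I * k + (k - 1)) (J * k) := by
    intro I J
    by_cases hI : I < k
    · by_cases hJ : J < k
      · obtain ⟨a, ha, c, hc, hne⟩ := hodd I J hI hJ
        obtain ⟨d, hd⟩ := choose_columns k (fun i c => w (I * k + i) (J * k + c)) a c 0 ha hc
          (by omega) hne (w (I * k + (k - 1)) (J * k))
        exact ⟨d, fun _ _ => hd⟩
      · exact ⟨id, fun _ h => absurd h hJ⟩
    · exact ⟨id, fun h => absurd h hI⟩
  choose d hd using hd
  let π : ℕ → ℕ → ZMod 2 := fun r c =>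
    ∑ i ∈ Finset.range (r % k), w (r / k * k + i) (c / k * k + d (r / k) (c / k) i)
  have hπ : ∀ I J i j, i < k → j < k → π (I * k + i) (J * k + j) =
      ∑ i ∈ Finset.range i, w (I * k + i) (J * k + d I J i) := by
    intro I J i j hi hj
    have hk : 0 < k := by omega
    have h1 : (I * k + i) / k = I := by
      rw [mul_comm, Nat.mul_add_div hk, Nat.div_eq_of_lt hi, add_zero]
    have h2 : (J * k + j) / k = J := by
      rw [mul_comm, Nat.mul_add_div hk, Nat.div_eq_of_lt hj, add_zero]
    have h3 : (I * k + i) % k = i := by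
      rw [mul_comm, Nat.mul_add_mod, Nat.mod_eq_of_lt hi]
    simp only [π, h1, h2, h3]
  let σ : (gridGraph (k ^ 2)).V → ZMod 2 := fun x => ρ (gr x) (gc x) + π (gr x) (gc x)
  let bs : (gridGraph k).V → Set (gridGraph (k ^ 2)).V := fun p =>
    {x | ∃ i < k, ∃ j < k, gr x = gr p * k + i ∧ gc x = gc p * k + j}
  have hpos : ∀ p : (gridGraph k).V, 0 < k := fun p => by have := gr_lt p; omega
  let base : (gridGraph k).V → (gridGraph (k ^ 2)).V := fun p =>
    gv (k ^ 2) (gr p * k + 0) (gc p * k + 0) (blk_lt (gr_lt p) (hpos p))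
      (blk_lt (gc_lt p) (hpos p))
  have ar : ∀ g r1 r2 p1 p2 x : ZMod 2, g + r1 + r2 = x → x + p1 + p2 = 0 →
      g + (r1 + p1) + (r2 + p2) = 0 := by decide
  have hbase : ∀ p, base p ∈ bs p := fun p => ⟨0, hpos p, 0, hpos p, rfl, rfl⟩
  refine Exists.elim (mkModel (gridGraph k) (gridGraph (k ^ 2)) (grid_ends_inj k)
    (γ₀ (gridGraph k)) γ σ bs base hbase ?_ ?_ ?_) ?_
  rotate_left 3
  · intro M hM
    refine ⟨M, fun p hp => ?_⟩
    rw [hM]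
    have hp0 : gr p = 0 := hp
    refine ⟨base p, hbase p, ?_⟩
    show gr p * k + 0 = 0
    rw [hp0]; simp
  · rintro u v x ⟨i, hi, j, hj, h1, h2⟩ ⟨i', hi', j', hj', h3, h4⟩
    apply grid_ext
    · exact (blk_unique hi hi' (h1.symm.trans h3)).1
    · exact (blk_unique hj hj' (h2.symm.trans h4)).1
  · intro p
    -- moving inside a row of the block
    have row : ∀ i, ∀ hi : i < k, ∀ j, ∀ hj : j < k,
        Relation.ReflTransGen (EStep (gridGraph (k ^ 2)) γ σ (bs p))
          (gv (k ^ 2) (gr p * k + i) (gc p * k + 0) (blk_lt (gr_lt p) hi)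
            (blk_lt (gc_lt p) (hpos p)))
          (gv (k ^ 2) (gr p * k + i) (gc p * k + j) (blk_lt (gr_lt p) hi)
            (blk_lt (gc_lt p) hj)) := by
      intro i hi j
      induction j with
      | zero => intro _; exact .refl
      | succ j ih =>
        intro hj
        refine (ih (by omega)).tail ?_
        obtain ⟨e, he, h0⟩ := hh (gr p * k + i) (gc p * k + j) (blk_lt (gr_lt p) hi)
          (blk_lt (gc_lt p) hj)
        refine ⟨⟨i, hi, j, by omega, rfl, rfl⟩, ⟨i, hi, j + 1, hj, rfl, rfl⟩, e, ?_, he⟩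
        refine ar _ _ _ _ _ _ h0 ?_
        simp only [gr_gv, gc_gv]
        rw [hπ _ _ _ _ hi (by omega), hπ _ _ _ _ hi hj, zero_add, zz]
    have col : ∀ i, ∀ hi : i < k,
        Relation.ReflTransGen (EStep (gridGraph (k ^ 2)) γ σ (bs p)) (base p)
          (gv (k ^ 2) (gr p * k + i) (gc p * k + 0) (blk_lt (gr_lt p) hi)
            (blk_lt (gc_lt p) (hpos p))) := by
      intro i
      induction i with
      | zero => intro _; exact .refl
      | succ i ih =>
        intro hi
        have hd1 : d (gr p) (gc p) i < k := (hd _ _ (gr_lt p) (gc_lt p)).1 i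
        refine (((ih (by omega)).trans (row i (by omega) _ hd1)).tail ?_).trans
          (EStep.rsymm (row (i + 1) hi _ hd1))
        obtain ⟨e, he, h0⟩ := hv (gr p * k + i) (gc p * k + d (gr p) (gc p) i)
          (blk_lt (gr_lt p) hi) (blk_lt (gc_lt p) hd1)
        refine ⟨⟨i, by omega, _, hd1, rfl, rfl⟩, ⟨i + 1, hi, _, hd1, rfl, rfl⟩, e, ?_, he⟩
        refine ar _ _ _ _ _ _ h0 ?_
        simp only [gr_gv, gc_gv]
        rw [hπ _ _ _ _ (by omega) hd1, hπ _ _ _ _ hi hd1, Finset.sum_range_succ]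
        generalize w (gr p * k + i) (gc p * k + d (gr p) (gc p) i) = x
        generalize ∑ i ∈ Finset.range i, w (gr p * k + i) (gc p * k + d (gr p) (gc p) i) = y
        revert x y; decide
    rintro x ⟨i, hi, j, hj, h1, h2⟩
    rw [eq_gv x h1 h2]
    exact (col i hi).trans (row i hi j hj)
  · intro eH
    rcases grid_edge_cases k eH with ⟨r, c, hr, hc, he⟩ | ⟨r, c, hr, hc, he⟩
    · have hk : c * k + (k - 1) + 1 = (c + 1) * k + 0 := by rw [add_mul]; omega
      obtain ⟨e, he', h0⟩ := hh (r * k + 0) (c * k + (k - 1)) (blk_lt hr (by omega))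
        (by rw [hk]; exact blk_lt hc (by omega))
      refine ⟨_, _, _, _, e, he, ?_, ?_, he', ?_⟩
      · exact ⟨0, by omega, k - 1, by omega, rfl, rfl⟩
      · exact ⟨0, by omega, 0, by omega, rfl, hk⟩
      refine ar _ _ _ _ _ _ h0 ?_
      simp only [gr_gv, gc_gv]
      rw [hk, hπ _ _ _ _ (by omega) (by omega), hπ _ _ _ _ (by omega) (by omega)]
      simp
    · have hk : r * k + (k - 1) + 1 = (r + 1) * k + 0 := by rw [add_mul]; omega
      obtain ⟨e, he', h0⟩ := hv (r * k + (k - 1)) (c * k + 0)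
        (by rw [hk]; exact blk_lt hr (by omega)) (blk_lt hc (by omega))
      refine ⟨_, _, _, _, e, he, ?_, ?_, he', ?_⟩
      · exact ⟨k - 1, by omega, 0, by omega, rfl, rfl⟩
      · exact ⟨0, by omega, 0, by omega, hk, rfl⟩
      refine ar _ _ _ _ _ _ h0 ?_
      simp only [gr_gv, gc_gv]
      rw [hk, hπ _ _ _ _ (by omega) (by omega), hπ _ _ _ _ (by omega) (by omega),
        (hd r c (by omega) hc).2]
      simp [zz]

lemma grid_signed (k : ℕ) (γ : (gridGraph (k ^ 2)).E → ZMod 2) :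
    IsRootedSignedMinor (gridGraph k) (γ₀ (gridGraph k)) (firstRow k)
      (gridGraph (k ^ 2)) γ (firstRow (k ^ 2)) := by
  obtain ⟨ρ, w, hh, hv⟩ := gauge (k ^ 2) γ
  by_cases h : ∃ I J, I < k ∧ J < k ∧
      ∀ a < k - 1, ∀ c < k, w (I * k + a) (J * k + c) = w (I * k + a) (J * k)
  · obtain ⟨I, J, hI, hJ, hev⟩ := h
    exact grid_evenBlock k γ ρ w hh hv I J hI hJ hev
  · push Not at h
    exact grid_oddBlocks k γ ρ w hh hv h

/-- Forbidding the rooted `k × k` grid as a rooted minor forbids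
the rooted grid `𝒲_k` as a rooted signed graph minor; conversely forbidding `𝒲_k`
as a rooted signed graph minor forbids the rooted `k² × k²` grid as a rooted minor. -/
theorem statement_8 (k : ℕ) (G : MGraph) (γ : G.E → ZMod 2) (K : Set G.V) :
    (¬ IsRootedMinor (gridGraph k) (firstRow k) G K →
      ¬ IsRootedSignedMinor (gridGraph k) (γ₀ (gridGraph k)) (firstRow k) G γ K) ∧
    (¬ IsRootedSignedMinor (gridGraph k) (γ₀ (gridGraph k)) (firstRow k) G γ K →
      ¬ IsRootedMinor (gridGraph (k ^ 2)) (firstRow (k ^ 2)) G K) := by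
  constructor
  · rintro h ⟨M, hM⟩
    refine h ⟨⟨M.bs, M.em, M.bs_nonempty, M.bs_disjoint, ?_, M.em_inj, M.em_ends⟩, hM⟩
    intro v a ha b hb
    refine rtg_mono ?_ (M.bs_connected v a ha b hb)
    rintro x y ⟨hx, hy, e, _, he⟩
    exact ⟨hx, hy, e, he⟩
  · intro h hm
    obtain ⟨γH, hs⟩ := signed_of_minor _ _ _ _ γ hm
    exact h (signed_trans _ _ _ _ _ _ _ _ _ (grid_signed k γH) hs)

end TDMPaper
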